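/- arXiv:2109.03214 — 4 statements merged into one kernel-verified Lean document; each statement's English description precedes it below -/
import Mathlib

section
/- Let m be a probability measure on a measurable space Ω and let f : Ω → ℝ be measurable with e^f integrable with respect to m and f·e^f integrable with respect to m; set Z = ∫ e^f dm > 0. Define the tilted probability measure q* by dq* = (e^f / Z) dm. Then: (i) q* is a probability measure and ∫ f dq* − KL(q*‖m) = log Z; and (ii) for every probability measure q absolutely continuous with respect to m such that f is integrable with respect to q and KL(q‖m) < ∞, one has ∫ f dq − KL(q‖m) ≤ log Z. (This is the variational characterization underlying the optimal encoder φ(z|s) ∝ m(z|z_{t−1}, a_{t−1}) e^{Q(s,z)} of Appendix A.3.) -/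
open MeasureTheory Classical

/-- The Kullback–Leibler divergence `KL(μ‖ν)`: equal to `∫ log (dμ/dν) dμ` when `μ ≪ ν`
and the log-density is `μ`-integrable, and `+∞` otherwise. -/
noncomputable def klDiv {Ω : Type*} [MeasurableSpace Ω] (μ ν : Measure Ω) : EReal :=
  if μ ≪ ν ∧ Integrable (llr μ ν) μ then ((∫ ω, llr μ ν ω ∂μ : ℝ) : EReal) else ⊤

/-- variational characterization of the optimal encoder: the tilted
measure `dq* = (e^f / Z) dm` is a probability measure attaining
`∫ f dq − KL(q‖m) = log Z`, and every probability measure `q ≪ m` satisfies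
`∫ f dq − KL(q‖m) ≤ log Z`. -/
theorem stmt5 {Ω : Type*} [MeasurableSpace Ω] (m : Measure Ω) [IsProbabilityMeasure m]
    (f : Ω → ℝ) (hf : Measurable f)
    (hexp : Integrable (fun ω => Real.exp (f ω)) m)
    (hfexp : Integrable (fun ω => f ω * Real.exp (f ω)) m)
    (Z : ℝ) (hZ : Z = ∫ ω, Real.exp (f ω) ∂m) (hZpos : 0 < Z) :
    (IsProbabilityMeasure (m.withDensity fun ω => ENNReal.ofReal (Real.exp (f ω) / Z)) ∧
      (∫ ω, f ω ∂(m.withDensity fun ω => ENNReal.ofReal (Real.exp (f ω) / Z)))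
          - (klDiv (m.withDensity fun ω => ENNReal.ofReal (Real.exp (f ω) / Z)) m).toReal
        = Real.log Z) ∧
    ∀ q : Measure Ω, IsProbabilityMeasure q → q ≪ m → Integrable f q →
      klDiv q m < ⊤ →
      (∫ ω, f ω ∂q) - (klDiv q m).toReal ≤ Real.log Z := by
  have hq : (m.withDensity fun ω => ENNReal.ofReal (Real.exp (f ω) / Z)) = m.tilted f := by
    rw [Measure.tilted, hZ]
  rw [hq]
  have hP : IsProbabilityMeasure (m.tilted f) := isProbabilityMeasure_tilted hexp
  refine ⟨⟨hP, ?_⟩, ?_⟩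
  · have hac : m.tilted f ≪ m := tilted_absolutelyContinuous m f
    have hfi : Integrable f (m.tilted f) := by
      rw [integrable_tilted_iff hexp f]
      simpa [smul_eq_mul, mul_comm] using hfexp
    have h1 : llr (m.tilted f) m =ᵐ[m] fun x => f x - Real.log Z := by
      have h := llr_tilted_left (μ := m) (ν := m) Measure.AbsolutelyContinuous.rfl hexp
        hf.aemeasurable
      filter_upwards [h, llr_self m] with x hx hx0
      rw [hx, hx0, hZ]
      simp
    have h2 := hac.ae_eq h1
    have hint : Integrable (llr (m.tilted f) m) (m.tilted f) := by
      rw [integrable_congr h2]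
      exact hfi.sub (integrable_const _)
    rw [klDiv, if_pos ⟨hac, hint⟩, EReal.toReal_coe, integral_congr_ae h2,
      integral_sub hfi (integrable_const _)]
    simp
  · intro q hqP hqm hfq hkl
    have hint : q ≪ m ∧ Integrable (llr q m) q := by
      by_contra h
      rw [klDiv, if_neg h] at hkl
      exact lt_irrefl _ hkl
    rw [klDiv, if_pos hint, EReal.toReal_coe]
    have hac : q ≪ m.tilted f := hqm.trans (absolutelyContinuous_tilted hexp)
    have h := InformationTheory.integral_llr_add_sub_measure_univ_nonneg hac
      (integrable_llr_tilted_right hqm hfq hint.2 hexp)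
    rw [integral_llr_tilted_right hqm hfq hexp hint.2, ← hZ] at h
    simp at h
    linarith
end

section
/- Let X and Z be measurable spaces, μ a probability measure on X, κ a Markov kernel from X to Z, ν a probability measure on Z, and let η = μ.bind κ be the marginal of Z (i.e., η(B) = ∫ κ(x)(B) dμ(x)). If ∫ KL(κ(x)‖ν) dμ(x) < ∞, then ∫ KL(κ(x)‖ν) dμ(x) = ∫ KL(κ(x)‖η) dμ(x) + KL(η‖ν). In particular ∫ KL(κ(x)‖ν) dμ(x) ≥ ∫ KL(κ(x)‖η) dμ(x), with equality when ν = η. (This is the decomposition justifying that the variational information bottleneck E_x[KL(p(z|x)‖m(z))] upper-bounds the mutual information I(x;z) for any prior m, and is tight for the marginal prior.) -/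
open MeasureTheory ProbabilityTheory Classical
open scoped ENNReal

/-- The canonical map `EReal → ℝ≥0∞`, sending `⊤` to `⊤` and a real `x` to
`ENNReal.ofReal x` (so negative values and `⊥` go to `0`).  It is faithful on the
nonnegative extended reals, in particular on KL divergences between probability measures. -/
noncomputable def erealToENNReal (x : EReal) : ℝ≥0∞ :=
  if x = ⊤ then ⊤ else ENNReal.ofReal x.toReal

lemma aux_kl_eq {Ω : Type*} [MeasurableSpace Ω] (μ ν : Measure Ω)
    [IsProbabilityMeasure μ] [IsProbabilityMeasure ν] :
    erealToENNReal (klDiv μ ν) = InformationTheory.klDiv μ ν := by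
  by_cases h : μ ≪ ν ∧ Integrable (llr μ ν) μ
  · rw [InformationTheory.klDiv_of_ac_of_integrable h.1 h.2]
    simp [erealToENNReal, klDiv, h]
  · have : InformationTheory.klDiv μ ν = ⊤ := by
      rw [InformationTheory.klDiv_eq_top_iff]
      tauto
    rw [this]
    simp [erealToENNReal, klDiv, h]

/-- Pointwise Young-type inequality. -/
lemma aux_young (f h : ℝ) (hf : 0 ≤ f) (hh : 0 ≤ h) :
    f * Real.log (max h 1) ≤ InformationTheory.klFun f + h := by
  have hm : 0 < max h 1 := lt_max_of_lt_right one_pos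
  have hm1 : max h 1 ≤ h + 1 := max_le (by linarith) (by linarith)
  rw [InformationTheory.klFun_apply]
  rcases hf.eq_or_lt with rfl | hf
  · simp; linarith
  have h1 := Real.log_le_sub_one_of_pos (div_pos hm hf)
  rw [Real.log_div hm.ne' hf.ne'] at h1
  have h2 := mul_le_mul_of_nonneg_left h1 hf.le
  have h3 : f * (max h 1 / f - 1) = max h 1 - f := by field_simp
  nlinarith

lemma aux_klFun_le (h : ℝ) (hh : 0 ≤ h) :
    InformationTheory.klFun h ≤ h * Real.log (max h 1) + 1 := by
  rw [InformationTheory.klFun_apply]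
  rcases le_total h 1 with h1 | h1
  · rw [max_eq_right h1]
    have := Real.log_nonpos hh h1
    simp
    nlinarith
  · rw [max_eq_left h1]; linarith

section
variable {Z : Type*} [MeasurableSpace Z]

noncomputable def auxG (η ν : Measure Z) (z : Z) : ℝ≥0∞ :=
  ENNReal.ofReal (Real.log (max (η.rnDeriv ν z).toReal 1))

lemma measurable_auxG (η ν : Measure Z) : Measurable (auxG η ν) := by
  unfold auxG; fun_prop

lemma aux_lintegral_G_le (ρ η ν : Measure Z) [IsProbabilityMeasure ρ] [IsProbabilityMeasure η]
    [IsProbabilityMeasure ν] :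
    ∫⁻ z, auxG η ν z ∂ρ ≤ InformationTheory.klDiv ρ ν + 1 := by
  by_cases hac : ρ ≪ ν
  swap
  · simp [hac]
  rw [InformationTheory.klDiv_eq_lintegral_klFun_of_ac hac,
    ← lintegral_rnDeriv_mul hac (measurable_auxG η ν).aemeasurable]
  have h1 : ∫⁻ z, η.rnDeriv ν z ∂ν ≤ 1 := by
    simpa using Measure.lintegral_rnDeriv_le (μ := η) (ν := ν)
  refine le_trans ?_ (add_le_add_right h1 _)
  rw [← lintegral_add_right _ (Measure.measurable_rnDeriv η ν)]
  refine lintegral_mono_ae ?_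
  filter_upwards [Measure.rnDeriv_lt_top ρ ν, Measure.rnDeriv_lt_top η ν] with z h1 h2
  have := aux_young _ _ (ENNReal.toReal_nonneg (a := ρ.rnDeriv ν z))
    (ENNReal.toReal_nonneg (a := η.rnDeriv ν z))
  unfold auxG
  nth_rewrite 1 [← ENNReal.ofReal_toReal h1.ne]
  nth_rewrite 2 [← ENNReal.ofReal_toReal h2.ne]
  rw [← ENNReal.ofReal_mul ENNReal.toReal_nonneg,
    ← ENNReal.ofReal_add (InformationTheory.klFun_nonneg ENNReal.toReal_nonneg)
      ENNReal.toReal_nonneg]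
  exact ENNReal.ofReal_le_ofReal this

lemma aux_kl_le (η ν : Measure Z) [IsProbabilityMeasure η]
    [IsProbabilityMeasure ν] (hac : η ≪ ν) :
    InformationTheory.klDiv η ν ≤ ∫⁻ z, auxG η ν z ∂η + 1 := by
  rw [InformationTheory.klDiv_eq_lintegral_klFun_of_ac hac,
    ← lintegral_rnDeriv_mul hac (measurable_auxG η ν).aemeasurable]
  have h1 : ∫⁻ z, 1 ∂ν = 1 := by simp
  rw [← h1, ← lintegral_add_right _ measurable_const]
  refine lintegral_mono_ae ?_
  filter_upwards [Measure.rnDeriv_lt_top η ν] with z h2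
  have := aux_klFun_le _ (ENNReal.toReal_nonneg (a := η.rnDeriv ν z))
  unfold auxG
  nth_rewrite 2 [← ENNReal.ofReal_toReal h2.ne]
  rw [← ENNReal.ofReal_mul ENNReal.toReal_nonneg, ← ENNReal.ofReal_one,
    ← ENNReal.ofReal_add (mul_nonneg ENNReal.toReal_nonneg
      (Real.log_nonneg (le_max_right _ _))) zero_le_one]
  exact ENNReal.ofReal_le_ofReal this

lemma aux_chain (ρ η ν : Measure Z) [IsProbabilityMeasure ρ] [IsProbabilityMeasure η]
    [IsProbabilityMeasure ν] (hac : η ≪ ν) (hint : Integrable (llr η ν) ρ)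
    (hpos : ∀ᵐ z ∂ρ, η.rnDeriv ν z ≠ 0) :
    InformationTheory.klDiv ρ ν + ENNReal.ofReal (-∫ z, llr η ν z ∂ρ)
      = InformationTheory.klDiv ρ η + ENNReal.ofReal (∫ z, llr η ν z ∂ρ) := by
  by_cases hρν : ρ ≪ ν
  swap
  · have : ¬ ρ ≪ η := fun h => hρν (h.trans hac)
    simp [hρν, this]
  have hρη : ρ ≪ η := by
    intro B hB
    rw [← Measure.withDensity_rnDeriv_eq η ν hac,
      withDensity_apply_eq_zero (Measure.measurable_rnDeriv η ν)] at hB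
    have h1 := hρν hB
    have h2 : ρ {z | η.rnDeriv ν z = 0} = 0 := by
      simpa [ae_iff] using hpos
    refine measure_mono_null ?_ (measure_union_null h1 h2)
    intro z hz
    by_cases h : η.rnDeriv ν z = 0
    · exact Or.inr h
    · exact Or.inl ⟨h, hz⟩
  have hllr : llr ρ ν =ᵐ[ρ] fun z => llr ρ η z + llr η ν z := by
    filter_upwards [hρν.ae_le (Measure.rnDeriv_mul_rnDeriv (κ := ν) hρη), Measure.rnDeriv_pos hρη,
      hpos, hρη.ae_le (Measure.rnDeriv_lt_top ρ η), hρν.ae_le (Measure.rnDeriv_lt_top η ν)]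
      with z h1 h2 h3 h4 h5
    simp only [llr, ← h1, Pi.mul_apply, ENNReal.toReal_mul]
    rw [Real.log_mul (ENNReal.toReal_pos h2.ne' h4.ne).ne' (ENNReal.toReal_pos h3 h5.ne).ne']
  by_cases hi : Integrable (llr ρ η) ρ
  · have hi' : Integrable (llr ρ ν) ρ := (integrable_congr hllr).2 (hi.add hint)
    have n1 := InformationTheory.integral_llr_add_sub_measure_univ_nonneg hρν hi'
    have n2 := InformationTheory.integral_llr_add_sub_measure_univ_nonneg hρη hi
    rw [InformationTheory.klDiv_of_ac_of_integrable hρν hi',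
      InformationTheory.klDiv_of_ac_of_integrable hρη hi]
    have e : ∫ z, llr ρ ν z ∂ρ = ∫ z, llr ρ η z ∂ρ + ∫ z, llr η ν z ∂ρ := by
      rw [integral_congr_ae hllr, integral_add hi hint]
    simp only [probReal_univ, add_sub_cancel_right] at n1 n2 ⊢
    rcases le_total 0 (∫ z, llr η ν z ∂ρ) with h | h
    · rw [ENNReal.ofReal_of_nonpos (neg_nonpos.2 h), add_zero, e, ENNReal.ofReal_add n2 h]
    · rw [ENNReal.ofReal_of_nonpos h, add_zero, ← ENNReal.ofReal_add n1 (neg_nonneg.2 h), e]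
      simp
  · have hi' : ¬ Integrable (llr ρ ν) ρ := by
      intro H
      apply hi
      refine (integrable_congr ?_).2 (H.sub hint)
      filter_upwards [hllr] with z hz
      simp [hz]
    simp [hi, hi']
end

/-- the variational information bottleneck is an upper bound on mutual
information, tight at the marginal: if `η = μ.bind κ` is the marginal of `Z` and
`∫ KL(κ(x)‖ν) dμ(x) < ∞`, then
`∫ KL(κ(x)‖ν) dμ = ∫ KL(κ(x)‖η) dμ + KL(η‖ν)`; in particular
`∫ KL(κ(x)‖ν) dμ ≥ ∫ KL(κ(x)‖η) dμ`. (The divergences between probability measures are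
nonnegative, so the integrals are Lebesgue integrals of the corresponding
`ℝ≥0∞`-valued functions.) -/
theorem stmt6 {X Z : Type*} [MeasurableSpace X] [MeasurableSpace Z]
    (μ : Measure X) [IsProbabilityMeasure μ] (κ : Kernel X Z) [IsMarkovKernel κ]
    (ν : Measure Z) [IsProbabilityMeasure ν]
    (η : Measure Z) (hη : η = μ.bind (fun x => κ x))
    (hfin : ∫⁻ x, erealToENNReal (klDiv (κ x) ν) ∂μ < ⊤) :
    ∫⁻ x, erealToENNReal (klDiv (κ x) ν) ∂μ
        = (∫⁻ x, erealToENNReal (klDiv (κ x) η) ∂μ) + erealToENNReal (klDiv η ν) ∧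
      ∫⁻ x, erealToENNReal (klDiv (κ x) η) ∂μ
        ≤ ∫⁻ x, erealToENNReal (klDiv (κ x) ν) ∂μ := by
  have hmk : AEMeasurable (fun x => κ x) μ := κ.measurable.aemeasurable
  have : IsProbabilityMeasure η := by
    rw [hη]; exact inferInstanceAs (IsProbabilityMeasure (κ ∘ₘ μ))
  simp only [aux_kl_eq] at hfin ⊢
  have hac : η ≪ ν := by
    refine Measure.AbsolutelyContinuous.mk fun B hB hνB => ?_
    rw [hη, Measure.bind_apply hB hmk, lintegral_eq_zero_iff (κ.measurable_coe hB)]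
    have hs : MeasurableSet {x | κ x B ≠ 0} :=
      (κ.measurable_coe hB) (measurableSet_singleton 0).compl
    have h1 : ∫⁻ x, Set.indicator {x | κ x B ≠ 0} (fun _ => ⊤) x ∂μ
        ≤ ∫⁻ x, InformationTheory.klDiv (κ x) ν ∂μ := by
      refine lintegral_mono fun x => ?_
      by_cases hx : κ x B = 0
      · simp [hx]
      · have : ¬ κ x ≪ ν := fun h => hx (h hνB)
        simp [this]
    rw [lintegral_indicator_const hs] at h1
    have h2 : μ {x | κ x B ≠ 0} = 0 := by
      by_contra h
      rw [ENNReal.top_mul h] at h1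
      exact absurd hfin (not_lt.2 h1)
    exact h2
  have hGfin : ∫⁻ z, auxG η ν z ∂η < ⊤ := by
    have e : ∫⁻ z, auxG η ν z ∂η = ∫⁻ x, ∫⁻ z, auxG η ν z ∂(κ x) ∂μ := by
      have := Measure.lintegral_bind hmk
        (measurable_auxG η ν).aemeasurable (f := auxG η ν)
      rwa [← hη] at this
    rw [e]
    refine lt_of_le_of_lt (lintegral_mono fun x => aux_lintegral_G_le (κ x) η ν) ?_
    rw [lintegral_add_right _ measurable_const]
    simpa using hfin
  have hKL : InformationTheory.klDiv η ν ≠ ⊤ :=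
    ((aux_kl_le η ν hac).trans_lt (by simpa using hGfin)).ne
  obtain ⟨-, hint⟩ := InformationTheory.klDiv_ne_top_iff.1 hKL
  have hη' : η = κ ∘ₘ μ := hη
  have hint' : Integrable (llr η ν) (κ ∘ₘ μ) := hη' ▸ hint
  have hae : ∀ᵐ x ∂μ, Integrable (llr η ν) (κ x) :=
    ((Measure.integrable_comp_iff hint'.1).1 hint').1
  have hpos : ∀ᵐ x ∂μ, ∀ᵐ z ∂(κ x), η.rnDeriv ν z ≠ 0 := by
    have : ∀ᵐ z ∂(κ ∘ₘ μ), η.rnDeriv ν z ≠ 0 := by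
      rw [← hη']
      filter_upwards [Measure.rnDeriv_pos hac] with z hz using hz.ne'
    exact Measure.ae_ae_of_ae_comp this
  set φ : X → ℝ := fun x => ∫ z, llr η ν z ∂(κ x) with hφ
  have hφm : Measurable φ :=
    ((stronglyMeasurable_llr η ν).integral_kernel (κ := κ)).measurable
  have hφi : Integrable φ μ := by
    have h := hint'
    rw [Measure.comp_eq_comp_const_apply] at h
    simpa using h.integral_comp
  have hφe : ∫ x, φ x ∂μ = ∫ z, llr η ν z ∂η := by
    conv_rhs => rw [show (∫ z, llr η ν z ∂η) = ∫ z, llr η ν z ∂(κ ∘ₘ μ) by rw [← hη']]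
    have h := hint'
    rw [Measure.comp_eq_comp_const_apply] at h ⊢
    rw [Kernel.integral_comp h]
    simp [hφ]
  have key : ∫⁻ x, InformationTheory.klDiv (κ x) ν ∂μ + ∫⁻ x, ENNReal.ofReal (-φ x) ∂μ
      = ∫⁻ x, InformationTheory.klDiv (κ x) η ∂μ + ∫⁻ x, ENNReal.ofReal (φ x) ∂μ := by
    rw [← lintegral_add_right _ (by fun_prop), ← lintegral_add_right _ (by fun_prop)]
    refine lintegral_congr_ae ?_
    filter_upwards [hae, hpos] with x h1 h2
    exact aux_chain (κ x) η ν hac h1 h2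
  have hkl : InformationTheory.klDiv η ν + ∫⁻ x, ENNReal.ofReal (-φ x) ∂μ
      = ∫⁻ x, ENNReal.ofReal (φ x) ∂μ := by
    have n := InformationTheory.integral_llr_add_sub_measure_univ_nonneg hac hint
    rw [InformationTheory.klDiv_of_ac_of_integrable hac hint]
    simp only [probReal_univ, add_sub_cancel_right] at n ⊢
    have f1 : ∫⁻ x, ENNReal.ofReal (φ x) ∂μ ≠ ⊤ := hφi.lintegral_lt_top.ne
    have f2 : ∫⁻ x, ENNReal.ofReal (-φ x) ∂μ ≠ ⊤ := hφi.neg.lintegral_lt_top.ne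
    have := integral_eq_lintegral_pos_part_sub_lintegral_neg_part hφi
    rw [hφe] at this
    rw [← ENNReal.ofReal_toReal f1, ← ENNReal.ofReal_toReal f2,
      ← ENNReal.ofReal_add n ENNReal.toReal_nonneg, this]
    congr 1
    ring
  have f2 : ∫⁻ x, ENNReal.ofReal (-φ x) ∂μ ≠ ⊤ := hφi.neg.lintegral_lt_top.ne
  have main : ∫⁻ x, InformationTheory.klDiv (κ x) ν ∂μ
      = ∫⁻ x, InformationTheory.klDiv (κ x) η ∂μ + InformationTheory.klDiv η ν := by
    rw [← hkl, ← add_assoc] at key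
    exact (ENNReal.add_left_inj f2).1 key
  exact ⟨main, main ▸ le_self_add⟩
end

section
/- Let γ ∈ (0,1), let E be a measurable space, and let p and q be probability measures on the sequence space ℕ → E equipped with the product σ-algebra. For each H ≥ 1 let π_H : (ℕ → E) → (Fin H → E) be the restriction to the first H coordinates, and set p_H = p.map π_H, q_H = q.map π_H. For each H ≥ 1 let g_H : (Fin H → E) → ℝ be measurable with g_H > 0 everywhere, g_H integrable with respect to p_H, log g_H integrable with respect to q_H, and KL(q_H‖p_H) < ∞. Assume the series ∑_{H=1}^∞ γ^H ∫ g_H dp_H and ∑_{H=1}^∞ γ^H (∫ log g_H dq_H − KL(q_H‖p_H)) converge absolutely, with the former having a positive sum. Then log( ∑_{H=1}^∞ γ^H ∫ g_H dp_H ) ≥ log(γ/(1−γ)) + ((1−γ)/γ) · ∑_{H=1}^∞ γ^H ( ∫ log g_H dq_H − KL(q_H‖p_H) ). (Abstract form of the core of Lemma 1: the log of the discounted expected return under the open-loop trajectory distribution p is lower-bounded by the discounted sum of expected log-rewards under the reactive trajectory distribution q, penalized by the KL divergences of the finite-horizon marginals.) -/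
open MeasureTheory Classical

lemma aux_gibbs {Ω : Type*} [MeasurableSpace Ω] (μ ν : Measure Ω) [IsProbabilityMeasure μ]
    [IsProbabilityMeasure ν] (g : Ω → ℝ) (hpos : ∀ y, 0 < g y) (hg : Integrable g ν)
    (hl : Integrable (fun y => Real.log (g y)) μ) (hk : klDiv μ ν < ⊤) :
    (∫ y, Real.log (g y) ∂μ) - (klDiv μ ν).toReal ≤ Real.log (∫ y, g y ∂ν) := by
  unfold klDiv at hk ⊢
  split_ifs at hk ⊢ with h
  · obtain ⟨hac, hint⟩ := h
    have he : (fun y => Real.exp (Real.log (g y))) = g := by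
      funext y
      exact Real.exp_log (hpos y)
    have hg' : Integrable (fun y => Real.exp (Real.log (g y))) ν := by rw [he]; exact hg
    have h1 := integral_llr_tilted_right hac hl hg' hint
    have h2 := integrable_llr_tilted_right hac hl hint hg'
    have hac2 := hac.trans (absolutelyContinuous_tilted hg')
    haveI := isProbabilityMeasure_tilted hg'
    have h3 := InformationTheory.integral_llr_add_sub_measure_univ_nonneg hac2 h2
    rw [h1, he] at h3
    simp at h3
    rw [EReal.toReal_coe]
    linarith
  · exact absurd hk (lt_irrefl _)

/-- abstract core of Lemma 1: on the sequence space `ℕ → E` with the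
product σ-algebra, writing `p_H, q_H` for the pushforwards of `p, q` under restriction
to the first `H` coordinates (the index `H : ℕ` below corresponds to horizon `H + 1 ≥ 1`),
and given positive measurable `g_H` with suitable integrability,
`log(∑_{H≥1} γ^H ∫ g_H dp_H) ≥ log(γ/(1−γ)) + ((1−γ)/γ) ∑_{H≥1} γ^H (∫ log g_H dq_H − KL(q_H‖p_H))`. -/
theorem stmt9 {E : Type*} [MeasurableSpace E] (γ : ℝ) (hγ0 : 0 < γ) (hγ1 : γ < 1)
    (p q : Measure (ℕ → E)) [IsProbabilityMeasure p] [IsProbabilityMeasure q]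
    (g : (H : ℕ) → (Fin (H + 1) → E) → ℝ)
    (pH qH : (H : ℕ) → Measure (Fin (H + 1) → E))
    (hpH : ∀ H : ℕ, pH H = p.map (fun ω (i : Fin (H + 1)) => ω i))
    (hqH : ∀ H : ℕ, qH H = q.map (fun ω (i : Fin (H + 1)) => ω i))
    (hgmeas : ∀ H : ℕ, Measurable (g H))
    (hgpos : ∀ (H : ℕ) (y : Fin (H + 1) → E), 0 < g H y)
    (hgint : ∀ H : ℕ, Integrable (g H) (pH H))
    (hlogint : ∀ H : ℕ, Integrable (fun y => Real.log (g H y)) (qH H))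
    (hKLfin : ∀ H : ℕ, klDiv (qH H) (pH H) < ⊤)
    (hsum1 : Summable (fun H : ℕ => |γ ^ (H + 1) * ∫ y, g H y ∂(pH H)|))
    (hsum2 : Summable (fun H : ℕ =>
      |γ ^ (H + 1) * ((∫ y, Real.log (g H y) ∂(qH H)) - (klDiv (qH H) (pH H)).toReal)|))
    (hpos : 0 < ∑' H : ℕ, γ ^ (H + 1) * ∫ y, g H y ∂(pH H)) :
    Real.log (∑' H : ℕ, γ ^ (H + 1) * ∫ y, g H y ∂(pH H))
      ≥ Real.log (γ / (1 - γ))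
        + (1 - γ) / γ * ∑' H : ℕ,
            γ ^ (H + 1) * ((∫ y, Real.log (g H y) ∂(qH H)) - (klDiv (qH H) (pH H)).toReal) := by
  have hmeas : ∀ H : ℕ, Measurable (fun (ω : ℕ → E) (i : Fin (H + 1)) => ω i) := by
    intro H
    fun_prop
  have ip : ∀ H, IsProbabilityMeasure (pH H) := by
    intro H
    rw [hpH]
    exact Measure.isProbabilityMeasure_map (hmeas H).aemeasurable
  have iq : ∀ H, IsProbabilityMeasure (qH H) := by
    intro H
    rw [hqH]
    exact Measure.isProbabilityMeasure_map (hmeas H).aemeasurable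
  have key : ∀ H, (∫ y, Real.log (g H y) ∂(qH H)) - (klDiv (qH H) (pH H)).toReal
      ≤ Real.log (∫ y, g H y ∂(pH H)) := fun H =>
    aux_gibbs _ _ (g H) (hgpos H) (hgint H) (hlogint H) (hKLfin H)
  have hA : ∀ H, 0 < ∫ y, g H y ∂(pH H) := by
    intro H
    rw [integral_pos_iff_support_of_nonneg (fun y => (hgpos H y).le) (hgint H)]
    have : Function.support (g H) = Set.univ := by
      ext y
      simp [(hgpos H y).ne']
    rw [this]
    simp
  have s1 := hsum1.of_abs
  have s2 := hsum2.of_abs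
  generalize hA' : (fun H => ∫ y, g H y ∂(pH H)) = A at *
  generalize ha' : (fun H => (∫ y, Real.log (g H y) ∂(qH H)) - (klDiv (qH H) (pH H)).toReal) = a
  have eA : ∀ H, ∫ y, g H y ∂(pH H) = A H := fun H => congrFun hA' H
  have ea : ∀ H, (∫ y, Real.log (g H y) ∂(qH H)) - (klDiv (qH H) (pH H)).toReal = a H :=
    fun H => congrFun ha' H
  simp only [eA, ea] at *
  set T := ∑' H : ℕ, γ ^ (H + 1) * A H with hT
  have h1γ : 0 < 1 - γ := by linarith
  have hw : HasSum (fun H : ℕ => γ ^ (H + 1)) (γ / (1 - γ)) := by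
    have := (hasSum_geometric_of_lt_one hγ0.le hγ1).mul_left γ
    simpa [pow_succ', div_eq_mul_inv] using this
  set W := γ / (1 - γ) with hW
  have hWpos : 0 < W := by positivity
  have hS : 0 < T / W := by positivity
  have bound : ∀ H, γ ^ (H + 1) * a H ≤
      (Real.log (T / W) - 1) * γ ^ (H + 1) + (W / T) * (γ ^ (H + 1) * A H) := by
    intro H
    have hl := Real.log_le_sub_one_of_pos (div_pos (hA H) hS)
    rw [Real.log_div (hA H).ne' hS.ne'] at hl
    have e : A H / (T / W) = W / T * A H := by field_simp
    rw [e] at hl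
    have : a H ≤ (Real.log (T / W) - 1) + W / T * A H := by linarith [key H]
    have h := mul_le_mul_of_nonneg_left this (pow_pos hγ0 (H + 1)).le
    linarith
  have hs := (hw.mul_left (Real.log (T / W) - 1)).add (s1.hasSum.mul_left (W / T))
  have fin := hasSum_le bound s2.hasSum hs
  rw [← hT] at fin
  have e2 : (Real.log (T / W) - 1) * W + W / T * T = Real.log (T / W) * W := by
    field_simp
    ring
  rw [e2, Real.log_div hpos.ne' hWpos.ne'] at fin
  have e3 : (1 - γ) / γ = W⁻¹ := by rw [hW, inv_div]
  rw [e3]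
  have := mul_le_mul_of_nonneg_left fin (inv_pos.mpr hWpos).le
  have e4 : W⁻¹ * ((Real.log T - Real.log W) * W) = Real.log T - Real.log W := by
    field_simp
  rw [e4] at this
  linarith
end

section
/- Let γ ∈ (0,1), let E be a measurable space, and let p and q be probability measures on the sequence space ℕ → E equipped with the product σ-algebra. For each H ≥ 1 let π_H : (ℕ → E) → (Fin H → E) be the restriction to the first H coordinates, and set p_H = p.map π_H, q_H = q.map π_H. For each H ≥ 1 let g_H : (Fin H → E) → ℝ be measurable with g_H > 0 everywhere, g_H integrable with respect to p_H, log g_H integrable with respect to q_H, and KL(q_H‖p_H) < ∞. Suppose there are real numbers c_t ≥ 0 (per-step information costs) such that KL(q_H‖p_H) ≤ ∑_{t=1}^{H} c_t for every H ≥ 1, and assume the series ∑_{H=1}^∞ γ^H ∫ g_H dp_H (with positive sum), ∑_{t=1}^∞ γ^t ∫ log g_t dq_t, and ∑_{t=1}^∞ γ^t c_t converge absolutely. Then log( ∑_{H=1}^∞ γ^H ∫ g_H dp_H ) ≥ log(γ/(1−γ)) + (1/γ) · ∑_{t=1}^∞ γ^t ( (1−γ) ∫ log g_t dq_t − c_t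 ). Equivalently, exponentiating, ∑_{H=1}^∞ γ^H ∫ g_H dp_H ≥ f( ∑_{t=1}^∞ γ^t ( (1−γ) ∫ log g_t dq_t − c_t ) ) with f(x) = (γ/(1−γ)) e^{x/γ}, which is the statement of Lemma 1 with c_t playing the role of the expected per-step cost E[log φ(z_t|s_t) − log m(z_t|z_{t−1}, a_{t−1})]. -/
open MeasureTheory Classical

/-- Donsker–Varadhan (easy direction). -/
lemma dv_bound {Ω : Type*} [MeasurableSpace Ω] (μ ν : Measure Ω) [IsProbabilityMeasure μ]
    [IsProbabilityMeasure ν] (g : Ω → ℝ) (hpos : ∀ y, 0 < g y)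
    (hint : Integrable g ν) (hlog : Integrable (fun y => Real.log (g y)) μ) (C : ℝ)
    (hlt : klDiv μ ν < ⊤) (hle : klDiv μ ν ≤ (C : EReal)) :
    Real.exp ((∫ y, Real.log (g y) ∂μ) - C) ≤ ∫ y, g y ∂ν := by
  unfold klDiv at hlt hle
  split_ifs at hlt hle with h
  · obtain ⟨hac, hllr⟩ := h
    have hle' : ∫ ω, llr μ ν ω ∂μ ≤ C := by exact_mod_cast hle
    have hexp : (fun x => Real.exp (Real.log (g x))) = g := by
      funext x; exact Real.exp_log (hpos x)
    have hint' : Integrable (fun x => Real.exp (Real.log (g x))) ν := by rw [hexp]; exact hint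
    have := isProbabilityMeasure_tilted hint'
    have h1 := integral_llr_tilted_right hac hlog hint' hllr
    have h2 := InformationTheory.integral_llr_add_sub_measure_univ_nonneg
      (hac.trans (absolutelyContinuous_tilted hint'))
      (integrable_llr_tilted_right hac hlog hllr hint')
    rw [hexp] at h1
    simp only [probReal_univ] at h2
    have hgp : 0 < ∫ y, g y ∂ν := by
      rw [← hexp]; exact integral_exp_pos hint'
    rw [← Real.le_log_iff_exp_le hgp]
    linarith
  · exact absurd hlt (lt_irrefl _)

/-- Lemma 1 with per-step information costs: on the sequence space
`ℕ → E`, with `p_H, q_H` the pushforwards of `p, q` under restriction to the first `H`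
coordinates (the index `H : ℕ` below corresponds to horizon `H + 1 ≥ 1`), positive
measurable rewards `g_H`, and nonnegative per-step costs `c_t` with
`KL(q_H‖p_H) ≤ ∑_{t=1}^H c_t`, we have
`log(∑_{H≥1} γ^H ∫ g_H dp_H) ≥ log(γ/(1−γ)) + (1/γ) ∑_{t≥1} γ^t ((1−γ) ∫ log g_t dq_t − c_t)`,
and, exponentiating, `∑_{H≥1} γ^H ∫ g_H dp_H ≥ f(∑_{t≥1} γ^t ((1−γ) ∫ log g_t dq_t − c_t))`
with `f(x) = (γ/(1−γ)) e^{x/γ}`. -/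
theorem stmt10 {E : Type*} [MeasurableSpace E] (γ : ℝ) (hγ0 : 0 < γ) (hγ1 : γ < 1)
    (p q : Measure (ℕ → E)) [IsProbabilityMeasure p] [IsProbabilityMeasure q]
    (g : (H : ℕ) → (Fin (H + 1) → E) → ℝ)
    (pH qH : (H : ℕ) → Measure (Fin (H + 1) → E))
    (hpH : ∀ H : ℕ, pH H = p.map (fun ω (i : Fin (H + 1)) => ω i))
    (hqH : ∀ H : ℕ, qH H = q.map (fun ω (i : Fin (H + 1)) => ω i))
    (hgmeas : ∀ H : ℕ, Measurable (g H))
    (hgpos : ∀ (H : ℕ) (y : Fin (H + 1) → E), 0 < g H y)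
    (hgint : ∀ H : ℕ, Integrable (g H) (pH H))
    (hlogint : ∀ H : ℕ, Integrable (fun y => Real.log (g H y)) (qH H))
    (hKLfin : ∀ H : ℕ, klDiv (qH H) (pH H) < ⊤)
    (c : ℕ → ℝ) (hc : ∀ t : ℕ, 1 ≤ t → 0 ≤ c t)
    (hKLle : ∀ H : ℕ, klDiv (qH H) (pH H) ≤ ((∑ t ∈ Finset.Icc 1 (H + 1), c t : ℝ) : EReal))
    (hsum1 : Summable (fun H : ℕ => |γ ^ (H + 1) * ∫ y, g H y ∂(pH H)|))
    (hsum2 : Summable (fun t : ℕ => |γ ^ (t + 1) * ∫ y, Real.log (g t y) ∂(qH t)|))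
    (hsum3 : Summable (fun t : ℕ => |γ ^ (t + 1) * c (t + 1)|))
    (hpos : 0 < ∑' H : ℕ, γ ^ (H + 1) * ∫ y, g H y ∂(pH H)) :
    Real.log (∑' H : ℕ, γ ^ (H + 1) * ∫ y, g H y ∂(pH H))
        ≥ Real.log (γ / (1 - γ))
          + (1 / γ) * ∑' t : ℕ,
              γ ^ (t + 1) * ((1 - γ) * (∫ y, Real.log (g t y) ∂(qH t)) - c (t + 1)) ∧
      ∑' H : ℕ, γ ^ (H + 1) * ∫ y, g H y ∂(pH H)
        ≥ (γ / (1 - γ)) * Real.exp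
            ((∑' t : ℕ, γ ^ (t + 1) * ((1 - γ) * (∫ y, Real.log (g t y) ∂(qH t)) - c (t + 1)))
              / γ) := by
  have hg1 : 0 < 1 - γ := by linarith
  have hmeas : ∀ H : ℕ, Measurable (fun (ω : ℕ → E) (i : Fin (H + 1)) => ω i) := by
    intro H; fun_prop
  set L : ℕ → ℝ := fun t => ∫ y, Real.log (g t y) ∂(qH t) with hL
  set G : ℕ → ℝ := fun t => ∫ y, g t y ∂(pH t) with hG
  have hLs : Summable (fun t => γ ^ (t + 1) * L t) := hsum2.of_abs
  have hGs : Summable (fun t => γ ^ (t + 1) * G t) := hsum1.of_abs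
  have hcs : Summable (fun t => γ ^ (t + 1) * c (t + 1)) := hsum3.of_abs
  set S : ℕ → ℝ := fun H => ∑ t ∈ Finset.range (H + 1), c (t + 1) with hS
  have hb : ∀ H, Real.exp (L H - S H) ≤ G H := by
    intro H
    have : IsProbabilityMeasure (pH H) := by
      rw [hpH]; exact Measure.isProbabilityMeasure_map (hmeas H).aemeasurable
    have : IsProbabilityMeasure (qH H) := by
      rw [hqH]; exact Measure.isProbabilityMeasure_map (hmeas H).aemeasurable
    refine dv_bound (qH H) (pH H) (g H) (hgpos H) (hgint H) (hlogint H) _ (hKLfin H) ?_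
    have e : S H = ∑ t ∈ Finset.Icc 1 (H + 1), c t := by
      rw [hS, ← Finset.Ico_add_one_right_eq_Icc, Finset.sum_Ico_eq_sum_range]
      simp [add_comm]
    rw [e]; exact hKLle H
  have hgeo : Summable (fun n : ℕ => γ ^ n) := summable_geometric_of_lt_one hγ0.le hγ1
  have hgeo' : Summable (fun n : ℕ => ‖γ ^ n‖) := hgeo.norm
  have hsum3' : Summable (fun t : ℕ => ‖γ ^ (t + 1) * c (t + 1)‖) := hsum3
  have hterm : ∀ H : ℕ, ∑ k ∈ Finset.range (H + 1), (γ ^ (k + 1) * c (k + 1)) * γ ^ (H - k)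
      = γ ^ (H + 1) * S H := by
    intro H
    rw [hS, Finset.mul_sum]
    refine Finset.sum_congr rfl fun k hk => ?_
    have hk' : k ≤ H := Nat.lt_succ_iff.mp (Finset.mem_range.mp hk)
    have : γ ^ (H + 1) = γ ^ (k + 1) * γ ^ (H - k) := by
      rw [← pow_add]; congr 1; omega
    rw [this]; ring
  have hSs : Summable (fun H => γ ^ (H + 1) * S H) := by
    have := (summable_norm_sum_mul_range_of_summable_norm hsum3' hgeo').of_norm
    simpa only [hterm] using this
  have hSt : ∑' H, γ ^ (H + 1) * S H = (∑' t, γ ^ (t + 1) * c (t + 1)) * (1 - γ)⁻¹ := by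
    have := tsum_mul_tsum_eq_tsum_sum_range_of_summable_norm hsum3' hgeo'
    simp only [hterm] at this
    rw [← this, tsum_geometric_of_lt_one hγ0.le hγ1]
  set TL := ∑' t, γ ^ (t + 1) * L t with hTL
  set TC := ∑' t, γ ^ (t + 1) * c (t + 1) with hTC
  have hX : ∑' t : ℕ, γ ^ (t + 1) * ((1 - γ) * L t - c (t + 1)) = (1 - γ) * TL - TC := by
    rw [hTL, hTC, ← tsum_mul_left, ← (hLs.mul_left (1 - γ)).tsum_sub hcs]
    congr 1; funext t; ring
  have hgeoT : HasSum (fun n : ℕ => γ ^ (n + 1)) (γ * (1 - γ)⁻¹) := by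
    simpa [pow_succ'] using (hasSum_geometric_of_lt_one hγ0.le hγ1).mul_left γ
  set A := ((1 - γ) * TL - TC) / γ with hA
  have hmain : γ / (1 - γ) * Real.exp A ≤ ∑' H, γ ^ (H + 1) * G H := by
    have hlow : HasSum (fun H : ℕ => Real.exp A * ((1 - A) * γ ^ (H + 1)
        + (γ ^ (H + 1) * L H - γ ^ (H + 1) * S H)))
        (Real.exp A * ((1 - A) * (γ * (1 - γ)⁻¹) + (TL - TC * (1 - γ)⁻¹))) := by
      refine HasSum.mul_left _ ((hgeoT.mul_left _).add (hLs.hasSum.sub ?_))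
      rw [← hSt]; exact hSs.hasSum
    have hle := hasSum_le (fun H => ?_) hlow hGs.hasSum
    · refine le_trans (le_of_eq ?_) hle
      rw [hA]; field_simp; ring
    · have h1 : Real.exp A * (1 + (L H - S H - A)) ≤ G H := by
        refine le_trans ?_ (hb H)
        have h2 := Real.add_one_le_exp (L H - S H - A)
        calc Real.exp A * (1 + (L H - S H - A))
            ≤ Real.exp A * Real.exp (L H - S H - A) := by
              apply mul_le_mul_of_nonneg_left _ (Real.exp_pos _).le; linarith
          _ = Real.exp (L H - S H) := by rw [← Real.exp_add]; congr 1; ring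
      have h3 := mul_le_mul_of_nonneg_left h1 (pow_pos hγ0 (H + 1)).le
      refine le_trans (le_of_eq ?_) h3
      ring
  have hf : 0 < γ / (1 - γ) := div_pos hγ0 hg1
  rw [hX]
  refine ⟨?_, hmain⟩
  have h := Real.log_le_log (mul_pos hf (Real.exp_pos A)) hmain
  rw [Real.log_mul hf.ne' (Real.exp_pos A).ne', Real.log_exp] at h
  rw [one_div_mul_eq_div]
  exact h
end
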